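/- Suppose condition 𝓤₀(η′,η) holds: 0 < η′ ≤ γ₀, η′ < η, s+1 ≤ η, and 𝓘^{η′}(0,S) < +∞. Then lim_{|t|→0} ‖P(t) − P‖_{η′,η} = 0, where ‖·‖_{η′,η} is the operator norm on bounded linear maps from (𝓑_{η′}, N_{∞,η′}) to (𝓑_η, N_{∞,η}). -/

import Mathlib

open MeasureTheory ProbabilityTheory Filter Topology
open scoped ENNReal NNReal

noncomputable section

/-- `p_λ(x) = 1 + λ d(x,x₀)` -/
def pfun {M : Type*} [MetricSpace M] (x₀ : M) (lam : ℝ) (x : M) : ℝ :=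
  1 + lam * dist x x₀

/-- `δ_λ(g) = max{c(g),1} + λ d(g x₀, x₀)` -/
def deltaFun {M G : Type*} [MetricSpace M] (x₀ : M) (act : G → M → M) (c : G → ℝ)
    (lam : ℝ) (g : G) : ℝ :=
  max (c g) 1 + lam * dist (act g x₀) x₀

/-- `δ̃(g) = 1 + c(g) + d(g x₀, x₀)` -/
def deltaTilde {M G : Type*} [MetricSpace M] (x₀ : M) (act : G → M → M) (c : G → ℝ)
    (g : G) : ℝ :=
  1 + c g + dist (act g x₀) x₀

/-- the weight `Δ_γ(x,y) = d(x,y) p(x)^γ p(y)^γ` -/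
def wDelta {M : Type*} [MetricSpace M] (x₀ : M) (lam γ : ℝ) (x y : M) : ℝ :=
  dist x y * pfun x₀ lam x ^ γ * pfun x₀ lam y ^ γ

/-- `m_γ(f)`, the best Lipschitz-type constant of `f` w.r.t. the weight `Δ_γ` -/
def mGam {M : Type*} [MetricSpace M] (x₀ : M) (lam γ : ℝ) (f : M → ℂ) : ℝ :=
  sSup {ρ : ℝ | ∃ x y : M, x ≠ y ∧ ρ = ‖f x - f y‖ / wDelta x₀ lam γ x y}

/-- `|f|_η = sup_x |f(x)|/p(x)^{η+1}` -/
def nrmGam {M : Type*} [MetricSpace M] (x₀ : M) (lam η : ℝ) (f : M → ℂ) : ℝ :=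
  sSup {ρ : ℝ | ∃ x : M, ρ = ‖f x‖ / pfun x₀ lam x ^ (η + 1)}

/-- membership in the space `𝓑_γ` -/
def memB {M : Type*} [MetricSpace M] (x₀ : M) (lam γ : ℝ) (f : M → ℂ) : Prop :=
  ∃ K : ℝ, ∀ x y : M, ‖f x - f y‖ ≤ K * wDelta x₀ lam γ x y

/-- the norm `N_{∞,γ}` on `𝓑_γ` -/
def nInf {M : Type*} [MetricSpace M] (x₀ : M) (lam γ : ℝ) (f : M → ℂ) : ℝ :=
  mGam x₀ lam γ f + nrmGam x₀ lam γ f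

/-- the Markov transition operator `P` acting on complex functions -/
def Pop {M G : Type*} [MeasurableSpace G] (π : Measure G) (act : G → M → M)
    (f : M → ℂ) (x : M) : ℂ :=
  ∫ g, f (act g x) ∂π

/-- the Markov transition operator `P` acting on real functions -/
def PopR {M G : Type*} [MeasurableSpace G] (π : Measure G) (act : G → M → M)
    (f : M → ℝ) (x : M) : ℝ :=
  ∫ g, f (act g x) ∂π

/-- the Fourier kernel `P(t)` -/
def Pt {M G : Type*} [MeasurableSpace G] (π : Measure G) (act : G → M → M)
    (ξ : G → M → ℝ) (t : ℝ) (f : M → ℂ) (x : M) : ℂ :=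
  ∫ g, Complex.exp (Complex.I * (t * ξ g x)) * f (act g x) ∂π

/-- the derivative kernels `L_k` -/
def Lk {M G : Type*} [MeasurableSpace G] (π : Measure G) (act : G → M → M)
    (ξ : G → M → ℝ) (k : ℕ) (f : M → ℂ) (x : M) : ℂ :=
  ∫ g, (Complex.I * (ξ g x : ℂ)) ^ k * f (act g x) ∂π

/-- `piStar π n` is the convolution power `π^{*(n+1)}`, the law of `R_{n+1} = Y_{n+1} ⋯ Y₁`. -/
def piStar {G : Type*} [MeasurableSpace G] [Mul G] (π : Measure G) : ℕ → Measure G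
  | 0 => π
  | n + 1 => Measure.map (fun q : G × G => q.1 * q.2) (π.prod (piStar π n))

/-- `ϑ₀ = ∫ c(g) δ_{λ₀}(g)^{2γ₀} dπ^{*n₀}(g)` (with `n₀` shifted by one). -/
def theta0 {M G : Type*} [MetricSpace M] [MeasurableSpace G] [Mul G] (x₀ : M)
    (act : G → M → M) (c : G → ℝ) (π : Measure G) (lam₀ γ₀ : ℝ) (n₀ : ℕ) : ℝ :=
  ∫ g, c g * deltaFun x₀ act c lam₀ g ^ (2 * γ₀) ∂(piStar π n₀)

/-- `𝓙^τ(U,V)` as a lower integral. -/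
def Jtau {M G : Type*} [MetricSpace M] [MeasurableSpace G] (x₀ : M) (act : G → M → M)
    (c : G → ℝ) (π : Measure G) (τ : ℝ) (U V : G → ℝ) : ℝ≥0∞ :=
  (∫⁻ g, ENNReal.ofReal (U g * (c g * deltaTilde x₀ act c g ^ (2 * τ))) ∂π) +
    ∫⁻ g, ENNReal.ofReal (V g * deltaTilde x₀ act c g ^ (τ + 1)) ∂π

/-- the random trajectory `Z_n`: `traj act Y Z n = R_n Z` where `R_n = Y_n ⋯ Y₁`
(`Y k` stands for `Y_{k+1}`). -/
def traj {M G Ω : Type*} (act : G → M → M) (Y : ℕ → Ω → G) (Z : Ω → M) : ℕ → Ω → M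
  | 0 => Z
  | n + 1 => fun ω => act (Y n ω) (traj act Y Z n ω)

/-- `S_n^Z = Σ_{k=1}^n ξ(Y_k, Z_{k-1})` -/
def Sn {M G Ω : Type*} (act : G → M → M) (ξ : G → M → ℝ) (Y : ℕ → Ω → G) (Z : Ω → M)
    (n : ℕ) (ω : Ω) : ℝ :=
  ∑ k ∈ Finset.range n, ξ (Y k ω) (traj act Y Z k ω)

/-- convergence in distribution, expressed through bounded continuous test functions -/
def CvgInDist {Ω : Type*} [MeasurableSpace Ω] (P : Measure Ω) (X : ℕ → Ω → ℝ)
    (μ : Measure ℝ) : Prop :=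
  ∀ f : ℝ → ℝ, Continuous f → (∃ C : ℝ, ∀ x, |f x| ≤ C) →
    Tendsto (fun n => ∫ ω, f (X n ω) ∂P) atTop (𝓝 (∫ x, f x ∂μ))

/-- the topological support of a measure -/
def msupport {M : Type*} [TopologicalSpace M] [MeasurableSpace M] (ν : Measure M) : Set M :=
  {x | ∀ U : Set M, IsOpen U → x ∈ U → 0 < ν U}

/-- the product `h* = h₁ ⋯ h_{k+1}` of a tuple of elements of the semigroup `G` -/
def hstar {G : Type*} [Semigroup G] : ∀ {k : ℕ}, (Fin (k + 1) → G) → G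
  | 0, h => h 0
  | _ + 1, h => h 0 * hstar (Fin.tail h)


section Weights

variable {M G : Type*} [MetricSpace M] {x₀ : M} {lam : ℝ}

lemma one_le_pfun (hlam : 0 ≤ lam) (x : M) : 1 ≤ pfun x₀ lam x := by
  have := mul_nonneg hlam (dist_nonneg (x := x) (y := x₀))
  unfold pfun; linarith

lemma pfun_pos (hlam : 0 ≤ lam) (x : M) : 0 < pfun x₀ lam x :=
  one_pos.trans_le (one_le_pfun hlam x)

lemma continuous_pfun : Continuous (pfun x₀ lam : M → ℝ) := by
  unfold pfun; fun_prop

lemma wDelta_nonneg (hlam : 0 ≤ lam) (γ : ℝ) (x y : M) : 0 ≤ wDelta x₀ lam γ x y := by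
  have := pfun_pos (x₀ := x₀) hlam x
  have := pfun_pos (x₀ := x₀) hlam y
  unfold wDelta; positivity

lemma wDelta_pos (hlam : 0 ≤ lam) (γ : ℝ) {x y : M} (hxy : x ≠ y) :
    0 < wDelta x₀ lam γ x y := by
  have := pfun_pos (x₀ := x₀) hlam x
  have := pfun_pos (x₀ := x₀) hlam y
  have := dist_pos.2 hxy
  unfold wDelta; positivity

lemma wDelta_comm (γ : ℝ) (x y : M) : wDelta x₀ lam γ x y = wDelta x₀ lam γ y x := by
  unfold wDelta; rw [dist_comm]; ring

lemma one_add_dist_le (hlam : 0 < lam) (hlam' : lam ≤ 1) (x : M) :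
    1 + dist x x₀ ≤ lam⁻¹ * pfun x₀ lam x := by
  rw [inv_mul_eq_div, le_div_iff₀ hlam]
  unfold pfun; nlinarith

variable {act : G → M → M} {c : G → ℝ}

lemma one_le_deltaFun (hlam : 0 ≤ lam) (g : G) : 1 ≤ deltaFun x₀ act c lam g := by
  have := mul_nonneg hlam (dist_nonneg (x := act g x₀) (y := x₀))
  have := le_max_right (c g) 1
  unfold deltaFun; linarith

lemma deltaFun_pos (hlam : 0 ≤ lam) (g : G) : 0 < deltaFun x₀ act c lam g :=
  one_pos.trans_le (one_le_deltaFun hlam g)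

lemma deltaFun_le_deltaTilde (hlam' : lam ≤ 1) {g : G} (hc : 0 ≤ c g) :
    deltaFun x₀ act c lam g ≤ deltaTilde x₀ act c g := by
  have h1 := mul_le_mul_of_nonneg_right hlam' (dist_nonneg (x := act g x₀) (y := x₀))
  have h2 : max (c g) 1 ≤ 1 + c g := max_le (by linarith) (by linarith)
  unfold deltaFun deltaTilde; linarith

lemma pfun_act_le (hlam : 0 ≤ lam) {g : G}
    (hcLip : ∀ x y : M, dist (act g x) (act g y) ≤ c g * dist x y) (x : M) :
    pfun x₀ lam (act g x) ≤ deltaFun x₀ act c lam g * pfun x₀ lam x := by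
  have h1 : dist (act g x) x₀ ≤ c g * dist x x₀ + dist (act g x₀) x₀ :=
    (dist_triangle _ (act g x₀) _).trans (by linarith [hcLip x x₀])
  have h2 : c g * dist x x₀ ≤ max (c g) 1 * dist x x₀ :=
    mul_le_mul_of_nonneg_right (le_max_left _ _) dist_nonneg
  have h3 := mul_le_mul_of_nonneg_left (h1.trans (add_le_add_left h2 _)) hlam
  have h4 := le_max_right (c g) 1
  have h5 : 0 ≤ lam * dist (act g x₀) x₀ * (lam * dist x x₀) := by positivity
  unfold pfun deltaFun
  linarith

lemma pfun_act_rpow_le (hlam : 0 ≤ lam) {g : G}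
    (hcLip : ∀ x y : M, dist (act g x) (act g y) ≤ c g * dist x y) {γ : ℝ} (hγ : 0 ≤ γ) (x : M) :
    pfun x₀ lam (act g x) ^ γ ≤ deltaFun x₀ act c lam g ^ γ * pfun x₀ lam x ^ γ := by
  rw [← Real.mul_rpow (deltaFun_pos hlam g).le (pfun_pos hlam x).le]
  exact Real.rpow_le_rpow (pfun_pos hlam _).le (pfun_act_le hlam hcLip x) hγ

lemma wDelta_act_le (hlam : 0 ≤ lam) {g : G} (hc : 0 ≤ c g)
    (hcLip : ∀ x y : M, dist (act g x) (act g y) ≤ c g * dist x y) {γ : ℝ} (hγ : 0 ≤ γ)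
    (x y : M) :
    wDelta x₀ lam γ (act g x) (act g y) ≤
      c g * deltaFun x₀ act c lam g ^ (2 * γ) * wDelta x₀ lam γ x y := by
  have hpx := pfun_pos (x₀ := x₀) hlam x
  have hpy := pfun_pos (x₀ := x₀) hlam y
  have hpgx := pfun_pos (x₀ := x₀) hlam (act g x)
  have hpgy := pfun_pos (x₀ := x₀) hlam (act g y)
  have hδ := deltaFun_pos (x₀ := x₀) (act := act) (c := c) hlam g
  calc wDelta x₀ lam γ (act g x) (act g y)
      ≤ (c g * dist x y) * (deltaFun x₀ act c lam g ^ γ * pfun x₀ lam x ^ γ) *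
          (deltaFun x₀ act c lam g ^ γ * pfun x₀ lam y ^ γ) := by
        unfold wDelta
        gcongr
        · exact hcLip x y
        · exact pfun_act_rpow_le hlam hcLip hγ x
        · exact pfun_act_rpow_le hlam hcLip hγ y
    _ = _ := by
        rw [two_mul, Real.rpow_add hδ]; unfold wDelta; ring

lemma measurable_deltaFun [MeasurableSpace M] [BorelSpace M] [MeasurableSpace G]
    (hactm : Measurable fun q : G × M => act q.1 q.2) (hcm : Measurable c) :
    Measurable (deltaFun x₀ act c lam) := by
  have h : Measurable fun g => act g x₀ := hactm.comp measurable_prodMk_right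
  have h' : Measurable fun g => dist (act g x₀) x₀ :=
    (continuous_id.dist continuous_const).measurable.comp h
  exact (hcm.max measurable_const).add (h'.const_mul lam)

end Weights

section WeightedLipschitz

variable {M : Type*} [MetricSpace M] {x₀ : M} {lam γ : ℝ} {f : M → ℂ}

lemma mGam_nonneg (hlam : 0 ≤ lam) : 0 ≤ mGam x₀ lam γ f := by
  refine Real.sSup_nonneg ?_
  rintro _ ⟨x, y, -, rfl⟩
  exact div_nonneg (norm_nonneg _) (wDelta_nonneg hlam _ _ _)

lemma nrmGam_nonneg (hlam : 0 ≤ lam) : 0 ≤ nrmGam x₀ lam γ f := by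
  refine Real.sSup_nonneg ?_
  rintro _ ⟨x, rfl⟩
  exact div_nonneg (norm_nonneg _) (Real.rpow_nonneg (pfun_pos hlam x).le _)

lemma memB.norm_sub_le (hlam : 0 ≤ lam) (hf : memB x₀ lam γ f) (x y : M) :
    ‖f x - f y‖ ≤ mGam x₀ lam γ f * wDelta x₀ lam γ x y := by
  obtain ⟨K, hK⟩ := hf
  rcases eq_or_ne x y with rfl | hxy
  · simp [wDelta]
  rw [← div_le_iff₀ (wDelta_pos hlam γ hxy)]
  refine le_csSup ⟨K, ?_⟩ ⟨x, y, hxy, rfl⟩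
  rintro _ ⟨u, v, huv, rfl⟩
  rw [div_le_iff₀ (wDelta_pos hlam γ huv)]
  exact hK u v

lemma memB.norm_le (hlam : 0 < lam) (hγ : 0 ≤ γ) (hf : memB x₀ lam γ f) (x : M) :
    ‖f x‖ ≤ nrmGam x₀ lam γ f * pfun x₀ lam x ^ (γ + 1) := by
  have hp := fun x : M => pfun_pos (x₀ := x₀) hlam.le x
  rw [← div_le_iff₀ (Real.rpow_pos_of_pos (hp x) _)]
  refine le_csSup ⟨‖f x₀‖ + mGam x₀ lam γ f * lam⁻¹, ?_⟩ ⟨x, rfl⟩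
  rintro _ ⟨y, rfl⟩
  rw [div_le_iff₀ (Real.rpow_pos_of_pos (hp y) _)]
  have h0 : pfun x₀ lam x₀ = 1 := by simp [pfun]
  have hd : dist y x₀ ≤ lam⁻¹ * pfun x₀ lam y := by
    rw [inv_mul_eq_div, le_div_iff₀ hlam]
    unfold pfun; linarith
  have h1 : wDelta x₀ lam γ y x₀ ≤ lam⁻¹ * pfun x₀ lam y ^ (γ + 1) := by
    rw [wDelta, h0, Real.one_rpow, mul_one, Real.rpow_add_one (hp y).ne']
    calc _ ≤ (lam⁻¹ * pfun x₀ lam y) * pfun x₀ lam y ^ γ :=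
          mul_le_mul_of_nonneg_right hd (Real.rpow_nonneg (hp y).le _)
      _ = _ := by ring
  have h2 : 1 ≤ pfun x₀ lam y ^ (γ + 1) :=
    Real.one_le_rpow (one_le_pfun hlam.le y) (by linarith)
  have h3 := hf.norm_sub_le hlam.le y x₀
  have h4 := mul_le_mul_of_nonneg_left h1 (mGam_nonneg (x₀ := x₀) (γ := γ) (f := f) hlam.le)
  have h5 := le_mul_of_one_le_right (norm_nonneg (f x₀)) h2
  have h6 : ‖f y‖ ≤ ‖f x₀‖ + ‖f y - f x₀‖ := by
    simpa using norm_add_le (f x₀) (f y - f x₀)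
  linarith

lemma memB.continuous (hlam : 0 ≤ lam) (hf : memB x₀ lam γ f) : Continuous f := by
  obtain ⟨K, hK⟩ := hf
  refine continuous_iff_continuousAt.2 fun x => ?_
  rw [ContinuousAt, tendsto_iff_norm_sub_tendsto_zero]
  have hc : Continuous fun y => pfun x₀ lam y ^ γ :=
    continuous_pfun.rpow_const fun y => Or.inl (pfun_pos hlam y).ne'
  have hw : Continuous fun y => K * wDelta x₀ lam γ y x := by
    unfold wDelta
    exact continuous_const.mul (((continuous_id.dist continuous_const).mul hc).mul
      continuous_const)
  have h := hw.tendsto x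
  simp only [wDelta, dist_self, zero_mul, mul_zero] at h
  exact squeeze_zero (fun _ => norm_nonneg _) (fun y => hK y x) h

lemma nInf_le_of_bounds (hlam : 0 ≤ lam) {A B : ℝ} (hA : 0 ≤ A)
    (hsub : ∀ x y, ‖f x - f y‖ ≤ A * wDelta x₀ lam γ x y)
    (hnorm : ∀ x, ‖f x‖ ≤ B * pfun x₀ lam x ^ (γ + 1)) :
    nInf x₀ lam γ f ≤ A + B := by
  refine add_le_add (Real.sSup_le ?_ hA) (csSup_le ⟨_, x₀, rfl⟩ ?_)
  · rintro _ ⟨x, y, hxy, rfl⟩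
    rw [div_le_iff₀ (wDelta_pos hlam γ hxy)]
    exact hsub x y
  · rintro _ ⟨x, rfl⟩
    rw [div_le_iff₀ (Real.rpow_pos_of_pos (pfun_pos hlam x) _)]
    exact hnorm x

end WeightedLipschitz

section Oscillation

lemma norm_cexp_I_mul (u : ℝ) : ‖Complex.exp (Complex.I * u)‖ = 1 := by
  rw [mul_comm]; exact Complex.norm_exp_ofReal_mul_I u

lemma norm_cexp_I_mul_sub_cexp_le (u v : ℝ) :
    ‖Complex.exp (Complex.I * u) - Complex.exp (Complex.I * v)‖ ≤ |u - v| := by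
  have h : Complex.exp (Complex.I * u) - Complex.exp (Complex.I * v) =
      Complex.exp (Complex.I * v) * (Complex.exp (Complex.I * ((u - v : ℝ) : ℂ)) - 1) := by
    rw [mul_sub, ← Complex.exp_add]; push_cast; ring_nf
  rw [h, norm_mul, norm_cexp_I_mul, one_mul, ← Real.norm_eq_abs]
  exact Real.norm_exp_I_mul_ofReal_sub_one_le

lemma norm_cexp_I_mul_sub_one_le_rpow {u k q θ : ℝ} (hθ : θ ≤ 1) (hθ0 : 0 ≤ θ) (hk : 0 ≤ k)
    (hq : 1 ≤ q) (hu : |u| ≤ k * q) :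
    ‖Complex.exp (Complex.I * u) - 1‖ ≤ 2 * (min 1 k ^ θ * q ^ θ) := by
  have hq0 : 0 ≤ q := zero_le_one.trans hq
  have h1 : ‖Complex.exp (Complex.I * u) - 1‖ ≤ |u| := by
    simpa using norm_cexp_I_mul_sub_cexp_le u 0
  have h2 : ‖Complex.exp (Complex.I * u) - 1‖ ≤ 2 :=
    (norm_sub_le _ _).trans (by rw [norm_cexp_I_mul, norm_one]; norm_num)
  have h3 : ‖Complex.exp (Complex.I * u) - 1‖ ≤ 2 * min 1 (k * q) := by
    rcases min_cases 1 (k * q) with ⟨h, -⟩ | ⟨h, -⟩ <;> rw [h]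
    · linarith
    · have := mul_nonneg hk hq0
      linarith
  have h4 : min 1 (k * q) ≤ min 1 (k * q) ^ θ :=
    Real.self_le_rpow_of_le_one (le_min zero_le_one (mul_nonneg hk hq0)) (min_le_left _ _) hθ
  have h5 : min 1 (k * q) ≤ min 1 k * q := by
    rw [min_mul_of_nonneg _ _ hq0, one_mul]
    exact min_le_min hq le_rfl
  have h6 := Real.rpow_le_rpow (le_min zero_le_one (mul_nonneg hk hq0)) h5 hθ0
  rw [Real.mul_rpow (le_min zero_le_one hk) hq0] at h6
  linarith

variable {G : Type*} [MeasurableSpace G] {π : Measure G} {K Φ : G → ℝ} {θ : ℝ}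

lemma integrable_min_rpow_mul (hK : Measurable K) (hK0 : ∀ g, 0 ≤ K g) (hΦ : Integrable Φ π)
    (hθ : 0 ≤ θ) (t : ℝ) : Integrable (fun g => min 1 (|t| * K g) ^ θ * Φ g) π := by
  refine hΦ.bdd_mul (c := 1)
    ((measurable_const.min (hK.const_mul _)).pow_const θ).aestronglyMeasurable
    (Eventually.of_forall fun g => ?_)
  have h0 : 0 ≤ min 1 (|t| * K g) := le_min zero_le_one (mul_nonneg (abs_nonneg _) (hK0 g))
  rw [Real.norm_of_nonneg (Real.rpow_nonneg h0 _)]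
  exact Real.rpow_le_one h0 (min_le_left _ _) hθ

lemma tendsto_integral_min_rpow_mul (hK : Measurable K) (hK0 : ∀ g, 0 ≤ K g)
    (hΦ : Integrable Φ π) (hθ : 0 < θ) :
    Tendsto (fun t : ℝ => ∫ g, min 1 (|t| * K g) ^ θ * Φ g ∂π) (𝓝 0) (𝓝 0) := by
  rw [← integral_zero G ℝ (μ := π)]
  refine tendsto_integral_filter_of_dominated_convergence (fun g => ‖Φ g‖)
    (Eventually.of_forall fun t =>
      (integrable_min_rpow_mul hK hK0 hΦ hθ.le t).aestronglyMeasurable)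
    (Eventually.of_forall fun t => Eventually.of_forall fun g => ?_) hΦ.norm
    (Eventually.of_forall fun g => ?_)
  · have h0 : 0 ≤ min 1 (|t| * K g) := le_min zero_le_one (mul_nonneg (abs_nonneg _) (hK0 g))
    rw [norm_mul, Real.norm_of_nonneg (Real.rpow_nonneg h0 _)]
    exact mul_le_of_le_one_left (norm_nonneg _) (Real.rpow_le_one h0 (min_le_left _ _) hθ.le)
  · have hc : Continuous fun t : ℝ => min 1 (|t| * K g) ^ θ * Φ g :=
      ((continuous_const.min (continuous_abs.mul continuous_const)).rpow_const
        fun _ => Or.inr hθ.le).mul continuous_const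
    have h := hc.tendsto 0
    simpa [Real.zero_rpow hθ.ne'] using h

lemma integrable_of_nonneg_of_le {Ψ : G → ℝ} (hΨm : Measurable Ψ) (hΨ0 : ∀ g, 0 ≤ Ψ g)
    (hle : ∀ g, Ψ g ≤ Φ g) (hfin : ∫⁻ g, ENNReal.ofReal (Φ g) ∂π < ⊤) : Integrable Ψ π := by
  refine ⟨hΨm.aestronglyMeasurable, ?_⟩
  rw [hasFiniteIntegral_iff_ofReal (Eventually.of_forall hΨ0)]
  exact (lintegral_mono fun g => ENNReal.ofReal_le_ofReal (hle g)).trans_lt hfin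

end Oscillation

section FourierKernel

variable {M G : Type*} [MetricSpace M] {x₀ : M} {act : G → M → M} {c : G → ℝ} {lam : ℝ}
  {ξ : G → M → ℝ}

lemma norm_cexp_cocycle_sub_one_le (hlam : 0 < lam) (hlam' : lam ≤ 1) {r θ a ρ : ℝ}
    (hr : 0 ≤ r) (hθ0 : 0 ≤ θ) (hθ : θ ≤ 1) (hθa : r * θ ≤ a) (hρ : 0 ≤ ρ) {g : G} {x : M}
    (hξ : |ξ g x| ≤ ρ * (1 + dist x x₀) ^ r) (t : ℝ) :
    ‖Complex.exp (Complex.I * (t * ξ g x)) - 1‖ ≤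
      2 * (min 1 (|t| * (ρ * lam⁻¹ ^ r)) ^ θ * pfun x₀ lam x ^ a) := by
  have hp1 := one_le_pfun (x₀ := x₀) hlam.le x
  have hp := pfun_pos (x₀ := x₀) hlam.le x
  have hl : 0 ≤ lam⁻¹ := (inv_pos.2 hlam).le
  have h1 : |t * ξ g x| ≤ |t| * (ρ * lam⁻¹ ^ r) * pfun x₀ lam x ^ r := by
    calc |t * ξ g x| = |t| * |ξ g x| := abs_mul _ _
      _ ≤ |t| * (ρ * (lam⁻¹ * pfun x₀ lam x) ^ r) := by
        gcongr
        exact hξ.trans (by gcongr; exact one_add_dist_le hlam hlam' x)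
      _ = _ := by rw [Real.mul_rpow hl hp.le]; ring
  have hk : 0 ≤ |t| * (ρ * lam⁻¹ ^ r) := by positivity
  have h2 := norm_cexp_I_mul_sub_one_le_rpow hθ hθ0 hk (Real.one_le_rpow hp1 hr) h1
  rw [← Real.rpow_mul hp.le] at h2
  push_cast at h2
  refine h2.trans ?_
  have := Real.rpow_le_rpow_of_exponent_le hp1 hθa
  have : 0 ≤ min 1 (|t| * (ρ * lam⁻¹ ^ r)) := le_min zero_le_one hk
  gcongr

lemma norm_comp_act_le (hlam : 0 ≤ lam) {γ b : ℝ} (hγ : 0 ≤ γ) (hb : 0 ≤ b) {f : M → ℂ}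
    (hf : ∀ x, ‖f x‖ ≤ b * pfun x₀ lam x ^ (γ + 1)) {g : G}
    (hcLip : ∀ x y : M, dist (act g x) (act g y) ≤ c g * dist x y) (x : M) :
    ‖f (act g x)‖ ≤ b * (deltaFun x₀ act c lam g ^ (γ + 1) * pfun x₀ lam x ^ (γ + 1)) :=
  (hf _).trans (mul_le_mul_of_nonneg_left
    (pfun_act_rpow_le hlam hcLip (by linarith) x) hb)

lemma rpow_mul_rpow_le_of_pfun_le (hlam : 0 < lam) (hlam' : lam ≤ 1) {s γ η : ℝ} (hs : 0 ≤ s)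
    (hγη : γ ≤ η) (hsη : s + 1 ≤ η) {x y : M} (hyx : pfun x₀ lam y ≤ pfun x₀ lam x) :
    (1 + dist x x₀ + dist y x₀) ^ s * pfun x₀ lam y ^ (γ + 1) ≤
      (2 * lam⁻¹) ^ s * (pfun x₀ lam x ^ η * pfun x₀ lam y ^ η) := by
  have hpx := pfun_pos (x₀ := x₀) hlam.le x
  have hpx1 := one_le_pfun (x₀ := x₀) hlam.le x
  have hpy := pfun_pos (x₀ := x₀) hlam.le y
  have hpy1 := one_le_pfun (x₀ := x₀) hlam.le y
  have hl : 0 < lam⁻¹ := inv_pos.2 hlam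
  have h1 : 1 + dist x x₀ + dist y x₀ ≤ 2 * lam⁻¹ * pfun x₀ lam x := by
    have hx := one_add_dist_le (x₀ := x₀) hlam hlam' x
    have hy := one_add_dist_le (x₀ := x₀) hlam hlam' y
    have := mul_le_mul_of_nonneg_left hyx hl.le
    linarith
  calc (1 + dist x x₀ + dist y x₀) ^ s * pfun x₀ lam y ^ (γ + 1)
      ≤ (2 * lam⁻¹ * pfun x₀ lam x) ^ s * (pfun x₀ lam y ^ γ * pfun x₀ lam x) := by
        rw [Real.rpow_add_one hpy.ne']; gcongr
    _ = (2 * lam⁻¹) ^ s * (pfun x₀ lam x ^ (s + 1) * pfun x₀ lam y ^ γ) := by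
        rw [Real.mul_rpow (by positivity) hpx.le, Real.rpow_add_one hpx.ne']; ring
    _ ≤ _ := by gcongr

lemma norm_cocycle_diff_le (hlam : 0 < lam) (hlam' : lam ≤ 1) {r s θ γ η m b ρ σ t : ℝ}
    (hr : 0 ≤ r) (hs : 0 ≤ s) (hθ0 : 0 ≤ θ) (hθ : θ ≤ 1) (hγ : 0 ≤ γ) (hγη : γ ≤ η)
    (hθη : r * θ ≤ η - γ) (hsη : s + 1 ≤ η) (hm : 0 ≤ m) (hb : 0 ≤ b) (hρ : 0 ≤ ρ)
    (hσ : 0 ≤ σ) {f : M → ℂ}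
    (hfsub : ∀ x y, ‖f x - f y‖ ≤ m * wDelta x₀ lam γ x y)
    (hf : ∀ x, ‖f x‖ ≤ b * pfun x₀ lam x ^ (γ + 1)) {g : G} (hc : 0 ≤ c g)
    (hcLip : ∀ x y : M, dist (act g x) (act g y) ≤ c g * dist x y) {x y : M}
    (hξx : |ξ g x| ≤ ρ * (1 + dist x x₀) ^ r)
    (hξxy : |ξ g x - ξ g y| ≤ σ * dist x y * (1 + dist x x₀ + dist y x₀) ^ s)
    (hyx : pfun x₀ lam y ≤ pfun x₀ lam x) :
    ‖(Complex.exp (Complex.I * (t * ξ g x)) - 1) * f (act g x) -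
        (Complex.exp (Complex.I * (t * ξ g y)) - 1) * f (act g y)‖ ≤
      (2 * m * (min 1 (|t| * (ρ * lam⁻¹ ^ r)) ^ θ *
          (c g * deltaFun x₀ act c lam g ^ (2 * γ))) +
        |t| * b * (2 * lam⁻¹) ^ s * (σ * deltaFun x₀ act c lam g ^ (γ + 1))) *
        wDelta x₀ lam η x y := by
  have hpx := pfun_pos (x₀ := x₀) hlam.le x
  have hpy := pfun_pos (x₀ := x₀) hlam.le y
  have hδ := deltaFun_pos (x₀ := x₀) (act := act) (c := c) hlam.le g
  have hw : 0 ≤ min 1 (|t| * (ρ * lam⁻¹ ^ r)) := le_min zero_le_one (by positivity)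
  have e1 := norm_cexp_cocycle_sub_one_le hlam hlam' hr hθ0 hθ hθη hρ hξx t
  have e2 : ‖f (act g x) - f (act g y)‖ ≤
      m * (c g * deltaFun x₀ act c lam g ^ (2 * γ) * wDelta x₀ lam γ x y) :=
    (hfsub _ _).trans (mul_le_mul_of_nonneg_left (wDelta_act_le hlam.le hc hcLip hγ x y) hm)
  have e3 : ‖Complex.exp (Complex.I * (t * ξ g x)) - Complex.exp (Complex.I * (t * ξ g y))‖ ≤
      |t| * (σ * dist x y * (1 + dist x x₀ + dist y x₀) ^ s) := by
    have h := norm_cexp_I_mul_sub_cexp_le (t * ξ g x) (t * ξ g y)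
    rw [← mul_sub, abs_mul] at h
    push_cast at h
    exact h.trans (mul_le_mul_of_nonneg_left hξxy (abs_nonneg t))
  have e4 := norm_comp_act_le hlam.le hγ hb hf hcLip y
  have e5 : pfun x₀ lam x ^ (η - γ) * wDelta x₀ lam γ x y ≤ wDelta x₀ lam η x y := by
    have h : pfun x₀ lam y ^ γ ≤ pfun x₀ lam y ^ η :=
      Real.rpow_le_rpow_of_exponent_le (one_le_pfun hlam.le y) hγη
    calc pfun x₀ lam x ^ (η - γ) * wDelta x₀ lam γ x y
        = dist x y * (pfun x₀ lam x ^ (η - γ) * pfun x₀ lam x ^ γ) * pfun x₀ lam y ^ γ := by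
          unfold wDelta; ring
      _ = dist x y * pfun x₀ lam x ^ η * pfun x₀ lam y ^ γ := by
          rw [← Real.rpow_add hpx, sub_add_cancel]
      _ ≤ wDelta x₀ lam η x y := by unfold wDelta; gcongr
  have e6 := rpow_mul_rpow_le_of_pfun_le hlam hlam' hs hγη hsη hyx
  calc _ = ‖(Complex.exp (Complex.I * (t * ξ g x)) - 1) * (f (act g x) - f (act g y)) +
        (Complex.exp (Complex.I * (t * ξ g x)) - Complex.exp (Complex.I * (t * ξ g y))) *
          f (act g y)‖ := by congr 1; ring
    _ ≤ _ := norm_add_le _ _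
    _ ≤ (2 * (min 1 (|t| * (ρ * lam⁻¹ ^ r)) ^ θ * pfun x₀ lam x ^ (η - γ))) *
          (m * (c g * deltaFun x₀ act c lam g ^ (2 * γ) * wDelta x₀ lam γ x y)) +
        (|t| * (σ * dist x y * (1 + dist x x₀ + dist y x₀) ^ s)) *
          (b * (deltaFun x₀ act c lam g ^ (γ + 1) * pfun x₀ lam y ^ (γ + 1))) := by
        rw [norm_mul, norm_mul]
        gcongr
    _ = 2 * m * (min 1 (|t| * (ρ * lam⁻¹ ^ r)) ^ θ *
          (c g * deltaFun x₀ act c lam g ^ (2 * γ))) *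
            (pfun x₀ lam x ^ (η - γ) * wDelta x₀ lam γ x y) +
        |t| * b * (σ * deltaFun x₀ act c lam g ^ (γ + 1)) * dist x y *
          ((1 + dist x x₀ + dist y x₀) ^ s * pfun x₀ lam y ^ (γ + 1)) := by ring
    _ ≤ 2 * m * (min 1 (|t| * (ρ * lam⁻¹ ^ r)) ^ θ *
          (c g * deltaFun x₀ act c lam g ^ (2 * γ))) * wDelta x₀ lam η x y +
        |t| * b * (σ * deltaFun x₀ act c lam g ^ (γ + 1)) * dist x y *
          ((2 * lam⁻¹) ^ s * (pfun x₀ lam x ^ η * pfun x₀ lam y ^ η)) := by gcongr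
    _ = _ := by unfold wDelta; ring

lemma integrable_cexp_mul_comp_act [MeasurableSpace M] [BorelSpace M] [MeasurableSpace G]
    {π : Measure G} (hactm : Measurable fun q : G × M => act q.1 q.2)
    (hξm : Measurable fun q : G × M => ξ q.1 q.2) {f : M → ℂ} (hf : Continuous f) {x : M}
    {Φ : G → ℝ} (hΦ : Integrable Φ π) (hle : ∀ g, ‖f (act g x)‖ ≤ Φ g) (t : ℝ) :
    Integrable (fun g => f (act g x)) π ∧
      Integrable (fun g => Complex.exp (Complex.I * (t * ξ g x)) * f (act g x)) π := by
  have hfm : Measurable fun g => f (act g x) :=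
    hf.measurable.comp (hactm.comp measurable_prodMk_right)
  have hξ : Measurable fun g => ξ g x := hξm.comp measurable_prodMk_right
  have hfi : Integrable (fun g => f (act g x)) π :=
    hΦ.mono' hfm.aestronglyMeasurable (Eventually.of_forall hle)
  refine ⟨hfi, hfi.bdd_mul (c := 1) (by fun_prop) (Eventually.of_forall fun g => ?_)⟩
  have h := norm_cexp_I_mul (t * ξ g x)
  push_cast at h
  exact h.le

end FourierKernel

/-- Proposition 6.2: under `𝓤₀(η′,η)`, `‖P(t) − P‖_{η′,η} → 0` as `t → 0`. -/
theorem stmt8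
    {M : Type*} [MetricSpace M] [ProperSpace M] [MeasurableSpace M] [BorelSpace M]
    {G : Type*} [Semigroup G] [MeasurableSpace G] [MeasurableMul₂ G]
    (x₀ : M) (act : G → M → M)
    (hact : ∀ (g h : G) (x : M), act (g * h) x = act g (act h x))
    (hactm : Measurable fun q : G × M => act q.1 q.2)
    (c : G → ℝ) (hcm : Measurable c)
    (hc0 : ∀ g : G, 0 ≤ c g)
    (hcLip : ∀ (g : G) (x y : M), dist (act g x) (act g y) ≤ c g * dist x y)
    (hcMin : ∀ (g : G) (K : ℝ), 0 ≤ K →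
      (∀ x y : M, dist (act g x) (act g y) ≤ K * dist x y) → c g ≤ K)
    (π : Measure G) [IsProbabilityMeasure π]
    -- condition 𝓗(γ₀)
    (γ₀ : ℝ) (hγ₀ : 0 < γ₀) (n₀ : ℕ)
    (hM : ∫⁻ g, ENNReal.ofReal (deltaTilde x₀ act c g ^ (γ₀ + 1)) ∂π < ⊤)
    (hM' : ∫⁻ g, ENNReal.ofReal (c g * deltaTilde x₀ act c g ^ (2 * γ₀)) ∂π < ⊤)
    (hC : ∫⁻ g, ENNReal.ofReal (c g * max (c g) 1 ^ (2 * γ₀)) ∂(piStar π n₀) < 1)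
    -- `λ₀ ∈ (0,1]` with `ϑ₀ < 1`
    (lam₀ : ℝ) (hlam₀ : 0 < lam₀) (hlam₀' : lam₀ ≤ 1)
    (hθ : ∫⁻ g, ENNReal.ofReal (c g * deltaFun x₀ act c lam₀ g ^ (2 * γ₀))
        ∂(piStar π n₀) < 1)
    -- condition RS
    (ξ : G → M → ℝ) (hξm : Measurable fun q : G × M => ξ q.1 q.2)
    (r s : ℝ) (hr : 0 ≤ r) (hs : 0 ≤ s)
    (R S : G → ℝ) (hRm : Measurable R) (hSm : Measurable S)
    (hR0 : ∀ g, 0 ≤ R g) (hS0 : ∀ g, 0 ≤ S g)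
    (hRS1 : ∀ (g : G) (x : M), |ξ g x| ≤ R g * (1 + dist x x₀) ^ r)
    (hRS2 : ∀ (g : G) (x y : M),
      |ξ g x - ξ g y| ≤ S g * dist x y * (1 + dist x x₀ + dist y x₀) ^ s)
    -- condition 𝓤₀(η′,η)
    (η' η : ℝ) (hη'pos : 0 < η') (hη'γ₀ : η' ≤ γ₀) (hη'η : η' < η) (hsη : s + 1 ≤ η)
    (hIS : ∫⁻ g, ENNReal.ofReal (S g * deltaFun x₀ act c lam₀ g ^ (η' + 1)) ∂π < ⊤) :
    -- `lim_{t→0} ‖P(t) − P‖_{η′,η} = 0`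
    ∀ ε : ℝ, 0 < ε → ∃ δ : ℝ, 0 < δ ∧ ∀ t : ℝ, |t| ≤ δ →
      ∀ f : M → ℂ, memB x₀ lam₀ η' f →
        memB x₀ lam₀ η (fun x => Pt π act ξ t f x - Pop π act f x) ∧
        nInf x₀ lam₀ η (fun x => Pt π act ξ t f x - Pop π act f x)
          ≤ ε * nInf x₀ lam₀ η' f := by
  have hδ := fun g => deltaFun_pos (x₀ := x₀) (act := act) (c := c) hlam₀.le g
  have hδ1 := fun g => one_le_deltaFun (x₀ := x₀) (act := act) (c := c) hlam₀.le g
  have hδm : Measurable (deltaFun x₀ act c lam₀) := measurable_deltaFun hactm hcm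
  have hδle : ∀ {u v : ℝ}, 0 ≤ v → u ≤ v → ∀ g,
      deltaFun x₀ act c lam₀ g ^ u ≤ deltaTilde x₀ act c g ^ v := fun hv huv g =>
    (Real.rpow_le_rpow_of_exponent_le (hδ1 g) huv).trans
      (Real.rpow_le_rpow (hδ g).le (deltaFun_le_deltaTilde hlam₀' (hc0 g)) hv)
  have hi1 : Integrable (fun g => deltaFun x₀ act c lam₀ g ^ (η' + 1)) π :=
    integrable_of_nonneg_of_le (hδm.pow_const _) (fun g => Real.rpow_nonneg (hδ g).le _)
      (hδle (by linarith) (by linarith)) hM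
  have hi2 : Integrable (fun g => c g * deltaFun x₀ act c lam₀ g ^ (2 * η')) π :=
    integrable_of_nonneg_of_le (hcm.mul (hδm.pow_const _))
      (fun g => mul_nonneg (hc0 g) (Real.rpow_nonneg (hδ g).le _))
      (fun g => mul_le_mul_of_nonneg_left (hδle (by linarith) (by linarith) g) (hc0 g)) hM'
  have hi3 : Integrable (fun g => S g * deltaFun x₀ act c lam₀ g ^ (η' + 1)) π :=
    integrable_of_nonneg_of_le (hSm.mul (hδm.pow_const _))
      (fun g => mul_nonneg (hS0 g) (Real.rpow_nonneg (hδ g).le _)) (fun _ => le_rfl) hIS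
  obtain ⟨θ, hθ0, hθ1, hθη⟩ : ∃ θ : ℝ, 0 < θ ∧ θ ≤ 1 ∧ r * θ ≤ η - η' := by
    have hr1 : 0 < r + 1 := by linarith
    have ha : 0 < (η - η') / (r + 1) := div_pos (by linarith) hr1
    refine ⟨min 1 ((η - η') / (r + 1)), lt_min one_pos ha, min_le_left _ _, ?_⟩
    calc r * min 1 ((η - η') / (r + 1)) ≤ (r + 1) * ((η - η') / (r + 1)) :=
          mul_le_mul (by linarith) (min_le_right _ _) (lt_min one_pos ha).le hr1.le
      _ = η - η' := mul_div_cancel₀ _ hr1.ne'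
  set K : G → ℝ := fun g => R g * lam₀⁻¹ ^ r
  have hl : 0 < lam₀⁻¹ := inv_pos.2 hlam₀
  have hKm : Measurable K := hRm.mul_const _
  have hK0 : ∀ g, 0 ≤ K g := fun g => mul_nonneg (hR0 g) (Real.rpow_nonneg hl.le _)
  have hw0 : ∀ (t : ℝ) g, 0 ≤ min 1 (|t| * K g) ^ θ := fun t g =>
    Real.rpow_nonneg (le_min zero_le_one (mul_nonneg (abs_nonneg _) (hK0 g))) _
  set I₁ : ℝ → ℝ := fun t =>
    ∫ g, min 1 (|t| * K g) ^ θ * deltaFun x₀ act c lam₀ g ^ (η' + 1) ∂π with hI₁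
  set I₂ : ℝ → ℝ := fun t =>
    ∫ g, min 1 (|t| * K g) ^ θ * (c g * deltaFun x₀ act c lam₀ g ^ (2 * η')) ∂π
  set I₃ : ℝ := ∫ g, S g * deltaFun x₀ act c lam₀ g ^ (η' + 1) ∂π
  have hI₁0 : ∀ t, 0 ≤ I₁ t := fun t =>
    integral_nonneg fun g => mul_nonneg (hw0 t g) (Real.rpow_nonneg (hδ g).le _)
  have hI₂0 : ∀ t, 0 ≤ I₂ t := fun t => integral_nonneg fun g =>
    mul_nonneg (hw0 t g) (mul_nonneg (hc0 g) (Real.rpow_nonneg (hδ g).le _))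
  have hI₃0 : 0 ≤ I₃ :=
    integral_nonneg fun g => mul_nonneg (hS0 g) (Real.rpow_nonneg (hδ g).le _)
  have hlim : Tendsto (fun t : ℝ => 2 * I₂ t + |t| * (2 * lam₀⁻¹) ^ s * I₃ + 2 * I₁ t)
      (𝓝 0) (𝓝 0) := by
    have h1 := (tendsto_integral_min_rpow_mul hKm hK0 hi1 hθ0).const_mul 2
    have h2 := (tendsto_integral_min_rpow_mul hKm hK0 hi2 hθ0).const_mul 2
    have h3 : Tendsto (fun t : ℝ => |t| * (2 * lam₀⁻¹) ^ s * I₃) (𝓝 0) (𝓝 0) := by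
      have h : Continuous fun t : ℝ => |t| * (2 * lam₀⁻¹) ^ s * I₃ := by fun_prop
      simpa using h.tendsto 0
    simpa using (h2.add h3).add h1
  intro ε hε
  obtain ⟨δ, hδpos, hδε⟩ := Metric.eventually_nhds_iff.1 (hlim.eventually (gt_mem_nhds hε))
  refine ⟨δ / 2, half_pos hδpos, fun t ht f hf => ?_⟩
  have htε : 2 * I₂ t + |t| * (2 * lam₀⁻¹) ^ s * I₃ + 2 * I₁ t < ε :=
    hδε (by rw [Real.dist_eq, sub_zero]; linarith)
  set m := mGam x₀ lam₀ η' f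
  set b := nrmGam x₀ lam₀ η' f
  have hm : 0 ≤ m := mGam_nonneg hlam₀.le
  have hb : 0 ≤ b := nrmGam_nonneg hlam₀.le
  have hfsub := hf.norm_sub_le hlam₀.le
  have hfle := hf.norm_le hlam₀ hη'pos.le
  have hfi := fun x => integrable_cexp_mul_comp_act (π := π) hactm hξm (hf.continuous hlam₀.le)
    ((hi1.mul_const (pfun x₀ lam₀ x ^ (η' + 1))).const_mul b)
    (fun g => norm_comp_act_le hlam₀.le hη'pos.le hb hfle (hcLip g) x) t
  have hsplit : ∀ x g, Complex.exp (Complex.I * (t * ξ g x)) * f (act g x) - f (act g x) =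
      (Complex.exp (Complex.I * (t * ξ g x)) - 1) * f (act g x) := fun x g => by ring
  have hint : ∀ x, Integrable
      (fun g => (Complex.exp (Complex.I * (t * ξ g x)) - 1) * f (act g x)) π := fun x => by
    simpa only [Pi.sub_def, hsplit] using (hfi x).2.sub (hfi x).1
  have heq : ∀ x, Pt π act ξ t f x - Pop π act f x =
      ∫ g, (Complex.exp (Complex.I * (t * ξ g x)) - 1) * f (act g x) ∂π := fun x => by
    simp only [← hsplit]
    exact (integral_sub (hfi x).2 (hfi x).1).symm
  have hnorm : ∀ x, ‖Pt π act ξ t f x - Pop π act f x‖ ≤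
      2 * I₁ t * b * pfun x₀ lam₀ x ^ (η + 1) := fun x => by
    have hp := pfun_pos (x₀ := x₀) hlam₀.le x
    rw [heq]
    have hbd := norm_integral_le_of_norm_le
      (f := fun g => (Complex.exp (Complex.I * (t * ξ g x)) - 1) * f (act g x))
      ((integrable_min_rpow_mul hKm hK0 hi1 hθ0.le t).const_mul
        (2 * b * pfun x₀ lam₀ x ^ (η + 1))) (Eventually.of_forall fun g => by
        have e1 := norm_cexp_cocycle_sub_one_le hlam₀ hlam₀' hr hθ0.le hθ1 hθη (hR0 g)
          (hRS1 g x) t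
        have e2 := norm_comp_act_le hlam₀.le hη'pos.le hb hfle (hcLip g) x
        rw [norm_mul]
        refine (mul_le_mul e1 e2 (norm_nonneg _) ((norm_nonneg _).trans e1)).trans_eq ?_
        have : pfun x₀ lam₀ x ^ (η + 1) =
            pfun x₀ lam₀ x ^ (η - η') * pfun x₀ lam₀ x ^ (η' + 1) := by
          rw [← Real.rpow_add hp]; ring_nf
        rw [this]
        ring)
    rw [integral_const_mul] at hbd
    exact hbd.trans_eq (by rw [hI₁]; ring)
  have hsub : ∀ x y, ‖(Pt π act ξ t f x - Pop π act f x) -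
      (Pt π act ξ t f y - Pop π act f y)‖ ≤
      (2 * m * I₂ t + |t| * b * (2 * lam₀⁻¹) ^ s * I₃) * wDelta x₀ lam₀ η x y := by
    intro x y
    wlog hyx : pfun x₀ lam₀ y ≤ pfun x₀ lam₀ x generalizing x y
    · rw [norm_sub_rev, wDelta_comm]
      exact this y x (le_of_not_ge hyx)
    rw [heq, heq, ← integral_sub (hint x) (hint y)]
    have hj2 := (integrable_min_rpow_mul hKm hK0 hi2 hθ0.le t).const_mul (2 * m)
    have hj3 := hi3.const_mul (|t| * b * (2 * lam₀⁻¹) ^ s)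
    have hbd := norm_integral_le_of_norm_le
      ((hj2.add hj3).mul_const (wDelta x₀ lam₀ η x y)) (Eventually.of_forall fun g =>
        norm_cocycle_diff_le (t := t) hlam₀ hlam₀' hr hs hθ0.le hθ1 hη'pos.le hη'η.le hθη hsη hm
          hb (hR0 g) (hS0 g) hfsub hfle (hc0 g) (hcLip g) (hRS1 g x) (hRS2 g x y) hyx)
    rw [integral_mul_const] at hbd
    simp only [Pi.add_apply] at hbd
    rw [integral_add hj2 hj3, integral_const_mul, integral_const_mul] at hbd
    exact hbd
  have hC0 : 0 ≤ |t| * (2 * lam₀⁻¹) ^ s * I₃ := by positivity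
  refine ⟨⟨_, hsub⟩, (nInf_le_of_bounds hlam₀.le ?_ hsub hnorm).trans ?_⟩
  · have := hI₂0 t
    positivity
  · have h2 : 2 * m * I₂ t ≤ 2 * (m + b) * I₂ t := by have := hI₂0 t; gcongr; linarith
    have h3 : (|t| * (2 * lam₀⁻¹) ^ s * I₃) * b ≤ (|t| * (2 * lam₀⁻¹) ^ s * I₃) * (m + b) := by
      gcongr; linarith
    have h1 : 2 * I₁ t * b ≤ 2 * I₁ t * (m + b) := by have := hI₁0 t; gcongr; linarith
    have h4 := mul_le_mul_of_nonneg_right htε.le (add_nonneg hm hb)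
    change _ ≤ ε * (m + b)
    linarith

end
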